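/- Let u, v be natural numbers with u, v ≥ 3 and 1/u + 1/v < 1/2, set w = u, and let A := b(u,v,u)⁻¹. Then the midpoint vector F₀₃ := e₀ + e₃ satisfies ⟨F₀₃, F₀₃⟩ = 2(A₀₀ + A₀₃) < 0; that is, F₀₃ is a proper (interior) point. -/

import Mathlib

open Real Matrix

/-- The Coxeter–Schläfli matrix `b(u,v,w)` of the orthoscheme. -/
noncomputable def CSMatrix (u v w : ℕ) : Matrix (Fin 4) (Fin 4) ℝ :=
  !![1, -Real.cos (Real.pi / u), 0, 0;
     -Real.cos (Real.pi / u), 1, -Real.cos (Real.pi / v), 0;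
     0, -Real.cos (Real.pi / v), 1, -Real.cos (Real.pi / w);
     0, 0, -Real.cos (Real.pi / w), 1]

/-- `A := b(u,v,w)⁻¹`. -/
noncomputable def Ainv (u v w : ℕ) : Matrix (Fin 4) (Fin 4) ℝ := (CSMatrix u v w)⁻¹

/-- The point scalar product `⟨x,y⟩ := xᵀ A y` with `A = b(u,v,w)⁻¹`. -/
noncomputable def ip (u v w : ℕ) (x y : Fin 4 → ℝ) : ℝ := x ⬝ᵥ (Ainv u v w).mulVec y

/-- The standard basis vector `e_i` of `ℝ⁴`. -/
noncomputable def e (i : Fin 4) : Fin 4 → ℝ := Pi.single i 1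

/-- The inverse of the Coxeter–Schläfli matrix of a symmetric orthoscheme. -/
lemma Ainv_symmetric_eq (u v : ℕ) {a c D : ℝ} (ha : cos (π / u) = a) (hc : cos (π / v) = c)
    (hD : (1 - a ^ 2) ^ 2 - c ^ 2 = D) (hD0 : D ≠ 0) :
    Ainv u v u = !![(1 - a ^ 2 - c ^ 2) / D, a * (1 - a ^ 2) / D, a * c / D, a ^ 2 * c / D;
      a * (1 - a ^ 2) / D, (1 - a ^ 2) / D, c / D, a * c / D;
      a * c / D, c / D, (1 - a ^ 2) / D, a * (1 - a ^ 2) / D;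
      a ^ 2 * c / D, a * c / D, a * (1 - a ^ 2) / D, (1 - a ^ 2 - c ^ 2) / D] := by
  unfold Ainv CSMatrix
  rw [ha, hc]
  apply Matrix.inv_eq_right_inv
  ext i j
  fin_cases i <;> fin_cases j <;>
    simp [Matrix.mul_apply, Fin.sum_univ_four] <;> field_simp <;> subst hD <;> ring

/-- In the hyperbolic range `1/u + 1/v < 1/2`, one has `sin² (π/u) < cos (π/v)`. -/
lemma one_sub_cos_sq_lt_cos {u v : ℕ} (hu : 3 ≤ u) (huv : (1 : ℝ) / u + 1 / v < 1 / 2) :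
    1 - cos (π / u) ^ 2 < cos (π / v) := by
  have hsum : π / u + π / v < π / 2 := by
    have := mul_lt_mul_of_pos_left huv pi_pos
    calc π / u + π / v = π * (1 / u + 1 / v) := by ring
      _ < π * (1 / 2) := this
      _ = π / 2 := by ring
  have hu0 : 0 < π / u := by positivity
  have hv0 : 0 ≤ π / v := by positivity
  have hlt : sin (π / u) < cos (π / v) := by
    rw [← cos_pi_div_two_sub]
    exact cos_lt_cos_of_nonneg_of_le_pi hv0 (by linarith) (by linarith)
  have hs : 0 ≤ sin (π / u) := sin_nonneg_of_nonneg_of_le_pi hu0.le (by linarith)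
  nlinarith [sin_sq_add_cos_sq (π / u), sin_le_one (π / u)]

theorem midpoint_F03_proper (u v : ℕ) (hu : 3 ≤ u) (hv : 3 ≤ v)
    (huv : (1 : ℝ) / u + 1 / v < 1 / 2) :
    ip u v u (e 0 + e 3) (e 0 + e 3) = 2 * (Ainv u v u 0 0 + Ainv u v u 0 3) ∧
    ip u v u (e 0 + e 3) (e 0 + e 3) < 0 := by
  have hlt := one_sub_cos_sq_lt_cos hu huv
  have hc1 : cos (π / v) < 1 := by
    have hv3 : (3 : ℝ) ≤ v := by exact_mod_cast hv
    rw [← cos_zero]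
    exact cos_lt_cos_of_nonneg_of_le_pi le_rfl
      (div_le_self pi_pos.le (by linarith)) (by positivity)
  have ha1 := cos_sq_le_one (π / u)
  generalize ha : cos (π / u) = a at *
  generalize hc : cos (π / v) = c at *
  have hpos : 0 < 1 + c - a ^ 2 := by linarith
  have hD : (1 - a ^ 2) ^ 2 - c ^ 2 < 0 := by nlinarith
  have hA := Ainv_symmetric_eq u v ha hc rfl hD.ne
  have hip : ip u v u (e 0 + e 3) (e 0 + e 3) = 2 * (Ainv u v u 0 0 + Ainv u v u 0 3) := by
    simp [ip, e, hA, Matrix.mulVec_add, add_dotProduct]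
    ring
  refine ⟨hip, ?_⟩
  have hsum : Ainv u v u 0 0 + Ainv u v u 0 3 =
      (1 - c) * (1 + c - a ^ 2) / ((1 - a ^ 2) ^ 2 - c ^ 2) := by
    simp [hA]
    ring
  rw [hip, hsum]
  exact mul_neg_of_pos_of_neg two_pos
    (div_neg_of_pos_of_neg (mul_pos (sub_pos.mpr hc1) hpos) hD)
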